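/- arXiv:1609.00705 — 3 statements merged into one kernel-verified Lean document; each statement's English description precedes it below -/
import Mathlib

section
/- Let m and k be real numbers with 0 < k < m/2. Then A₂(m,k) := 3k^4 − 6mk^3 + (3m^2 − 12m − 30)k^2 + (12m^2 + 30m)k + 9m^2 + 36m + 27 > 0 and B₁(m,k) := −6k^2 + 6mk + 12m + 30 > 0. -/
/-- If 0 < k < m/2 then A₂(m,k) > 0 and B₁(m,k) > 0. -/
theorem A2_B1_pos (m k : ℝ) (hk0 : 0 < k) (hk : k < m / 2) :
    3*k^4 - 6*m*k^3 + (3*m^2 - 12*m - 30)*k^2 + (12*m^2 + 30*m)*k + 9*m^2 + 36*m + 27 > 0 ∧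
    -6*k^2 + 6*m*k + 12*m + 30 > 0 := by
  have hm : 0 < m := by linarith
  have ht : 0 < k * (m - k) := mul_pos hk0 (by linarith)
  constructor
  · have h : 0 < 3 * (k * (m - k))^2 + (12 * m + 30) * (k * (m - k)) + 9 * m^2 + 36 * m + 27 := by
      positivity
    linarith
  · linarith
end

section
/- Let s > 0 and let n be a real number with n > 2s + 6 + √73, and set m := n − 2s. Then 5m − √(15m² + 120m + 370) > 0, and (n+2s)/(n−2s) < (5n + 10s − √(15m² + 120m + 370)) / (5n − 10s − √(15m² + 120m + 370)). -/
open Real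

/-- For n > 2s + 6 + √73 the denominator of p_m(n) is positive and
p_m(n) exceeds the Sobolev exponent. -/
theorem pm_above_sobolev (n s : ℝ) (hs : 0 < s)
    (hn : n > 2*s + 6 + Real.sqrt 73) :
    5*(n - 2*s) - Real.sqrt (15*(n - 2*s)^2 + 120*(n - 2*s) + 370) > 0 ∧
    (n + 2*s) / (n - 2*s)
      < (5*n + 10*s - Real.sqrt (15*(n - 2*s)^2 + 120*(n - 2*s) + 370))
        / (5*n - 10*s - Real.sqrt (15*(n - 2*s)^2 + 120*(n - 2*s) + 370)) := by
  obtain ⟨m, rfl⟩ : ∃ m, n = m + 2 * s := ⟨n - 2 * s, by ring⟩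
  have hm : 6 + √73 < m := by linarith
  have hm0 : 0 < m := by linarith [Real.sqrt_nonneg 73]
  have hquad : 0 < m ^ 2 - 12 * m - 37 := by
    nlinarith [Real.sq_sqrt (show (0 : ℝ) ≤ 73 by norm_num), Real.sqrt_nonneg 73]
  rw [add_sub_cancel_right]
  set r := √(15 * m ^ 2 + 120 * m + 370)
  have hr : 0 < r := Real.sqrt_pos.2 (by positivity)
  have hr5 : r < 5 * m := (Real.sqrt_lt' (by positivity)).2 (by linarith)
  refine ⟨by linarith, ?_⟩
  rw [div_lt_div_iff₀ hm0 (by linarith)]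
  linarith [mul_pos hs hr]
end

section
/- Let s, n, a be real numbers with 2 < s < 3, m := n − 2s > 6 + √73, 0 < a < 1, and n − 2s − 2 − 2a√n > 0. Then (5n + 10s − √(15m² + 120m + 370)) / (5n − 10s − √(15m² + 120m + 370)) > (n + 2s − 2 − 2a√n) / (n − 2s − 2 − 2a√n). -/
open Real

/-- Comparison p_c(n) < p_m(n). -/
theorem pc_lt_pm (s n a : ℝ) (hs1 : 2 < s) (hs2 : s < 3)
    (hm : n - 2*s > 6 + Real.sqrt 73) (ha0 : 0 < a) (ha1 : a < 1)
    (hden : n - 2*s - 2 - 2*a*Real.sqrt n > 0) :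
    (5*n + 10*s - Real.sqrt (15*(n - 2*s)^2 + 120*(n - 2*s) + 370))
        / (5*n - 10*s - Real.sqrt (15*(n - 2*s)^2 + 120*(n - 2*s) + 370))
      > (n + 2*s - 2 - 2*a*Real.sqrt n) / (n - 2*s - 2 - 2*a*Real.sqrt n) := by
  have h73 : (8 : ℝ) < √73 := Real.lt_sqrt_of_sq_lt (by norm_num)
  have h73sq : √73 ^ 2 = 73 := Real.sq_sqrt (by norm_num)
  have hn : 0 ≤ n := by linarith
  have hr0 : 0 ≤ √n := Real.sqrt_nonneg n
  have hrsq : √n ^ 2 = n := Real.sq_sqrt hn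
  have har : a * √n ≤ √n := mul_le_of_le_one_left hr0 ha1.le
  have hlower : 10 + 10 * √n < √(15*(n - 2*s)^2 + 120*(n - 2*s) + 370) := by
    apply Real.lt_sqrt_of_sq_lt
    nlinarith [sq_nonneg (√n - 5)]
  have hupper : √(15*(n - 2*s)^2 + 120*(n - 2*s) + 370) < 5 * (n - 2*s) := by
    rw [Real.sqrt_lt' (by linarith)]
    nlinarith
  generalize √(15*(n - 2*s)^2 + 120*(n - 2*s) + 370) = R at *
  rw [gt_iff_lt, div_lt_div_iff₀ hden (by linarith)]
  nlinarith [mul_pos (show 0 < s by linarith) (show 0 < R - 10 - 10 * (a * √n) by linarith)]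
end
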